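/- Let v, Δ be nonnegative integers. Then for every real λ with 0 < λ ≤ 1, Φ_{v,Δ}(λ) ≤ (1+λ)^v / (1+λ^{Δ+v}). -/

import Mathlib

/-- The local factor `Φ_{v,Δ}(λ) = (Σ_{t=0}^{v} binom(v,t) λ^{min{t, Δ+v−t}}) / (1 + λ^Δ)`. -/
noncomputable def localFactor (v Δ : ℕ) (lam : ℝ) : ℝ :=
  (∑ t ∈ Finset.range (v + 1), (v.choose t : ℝ) * lam ^ (min t (Δ + v - t))) / (1 + lam ^ Δ)

theorem pow_min_mul_one_add_pow_le {t n : ℕ} (ht : t ≤ n) {x : ℝ} (hx0 : 0 ≤ x) (hx1 : x ≤ 1) :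
    x ^ min t (n - t) * (1 + x ^ n) ≤ x ^ t + x ^ (n - t) := by
  rw [mul_add, mul_one, ← pow_add]
  rcases le_total t (n - t) with h | h
  · rw [min_eq_left h]
    gcongr x ^ t + ?_
    exact pow_le_pow_of_le_one hx0 hx1 (by omega)
  · rw [min_eq_right h, add_comm (x ^ t)]
    gcongr x ^ (n - t) + ?_
    exact pow_le_pow_of_le_one hx0 hx1 (by omega)

theorem sum_choose_mul_pow_add_pow (v d : ℕ) (x : ℝ) :
    ∑ t ∈ Finset.range (v + 1), (v.choose t : ℝ) * (x ^ t + x ^ (d + v - t)) =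
      (1 + x) ^ v * (1 + x ^ d) := by
  have h1 : (1 + x) ^ v = ∑ t ∈ Finset.range (v + 1), (v.choose t : ℝ) * x ^ t := by
    rw [add_comm, add_pow]
    exact Finset.sum_congr rfl fun t _ => by ring
  have h2 : (1 + x) ^ v = ∑ t ∈ Finset.range (v + 1), (v.choose t : ℝ) * x ^ (v - t) := by
    rw [add_pow]
    exact Finset.sum_congr rfl fun t _ => by ring
  rw [mul_add, mul_one]
  nth_rw 1 [h1]
  rw [h2, Finset.sum_mul, ← Finset.sum_add_distrib]
  refine Finset.sum_congr rfl fun t ht => ?_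
  rw [Nat.add_sub_assoc (Finset.mem_range_succ_iff.mp ht), pow_add]
  ring

/-- for nonnegative integers `v, Δ` and `0 < λ ≤ 1`,
`Φ_{v,Δ}(λ) ≤ (1+λ)^v / (1+λ^{Δ+v})`. -/
theorem localFactor_le_ratio (v Δ : ℕ) (lam : ℝ) (hlam0 : 0 < lam) (hlam1 : lam ≤ 1) :
    localFactor v Δ lam ≤ (1 + lam) ^ v / (1 + lam ^ (Δ + v)) := by
  rw [localFactor, div_le_div_iff₀ (by positivity) (by positivity),
    ← sum_choose_mul_pow_add_pow, Finset.sum_mul]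
  refine Finset.sum_le_sum fun t ht => ?_
  have htv := Finset.mem_range_succ_iff.mp ht
  rw [mul_assoc]
  exact mul_le_mul_of_nonneg_left
    (pow_min_mul_one_add_pow_le (by omega) hlam0.le hlam1) (Nat.cast_nonneg _)
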